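/- Let V be a finite-dimensional complex Hilbert space and let h, k be two distinct unitary operators on V. Then the set of x ∈ V with ⟨x, hx⟩ ≠ ⟨x, kx⟩ contains an open dense subset of V. -/

import Mathlib

open scoped InnerProductSpace ComplexInnerProductSpace

/-- For distinct unitaries `h, k` on a finite-dimensional complex Hilbert space `V`,
the set of `x` with `⟪x, h x⟫ ≠ ⟪x, k x⟫` contains an open dense subset. -/
theorem stmt_2 (V : Type*) [NormedAddCommGroup V] [InnerProductSpace ℂ V]
    [FiniteDimensional ℂ V] (h k : V ≃ₗᵢ[ℂ] V) (hhk : h ≠ k) :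
    ∃ U : Set V, IsOpen U ∧ Dense U ∧
      U ⊆ {x : V | ⟪x, h x⟫_ℂ ≠ ⟪x, k x⟫_ℂ} := by
  refine ⟨{x : V | ⟪x, h x⟫_ℂ ≠ ⟪x, k x⟫_ℂ}, ?_, ?_, subset_rfl⟩
  · exact isOpen_ne_fun (continuous_id.inner h.continuous) (continuous_id.inner k.continuous)
  obtain ⟨y, hy⟩ : ∃ y : V, ⟪y, h y⟫_ℂ ≠ ⟪y, k y⟫_ℂ := by
    by_contra! H
    apply hhk
    have := (ext_inner_map (h.toLinearEquiv : V →ₗ[ℂ] V) (k.toLinearEquiv : V →ₗ[ℂ] V)).1 (by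
      intro x
      have := congrArg (starRingEnd ℂ) (H x)
      simp only [inner_conj_symm] at this
      exact this)
    ext x
    exact LinearMap.congr_fun this x
  intro x
  set c : ℂ := ⟪y, h y⟫_ℂ - ⟪y, k y⟫_ℂ with hc
  set b : ℂ := ⟪x, h y⟫_ℂ + ⟪y, h x⟫_ℂ - ⟪x, k y⟫_ℂ - ⟪y, k x⟫_ℂ with hb
  set a : ℂ := ⟪x, h x⟫_ℂ - ⟪x, k x⟫_ℂ with ha
  let p : Polynomial ℂ := Polynomial.C c * Polynomial.X ^ 2 + Polynomial.C b * Polynomial.X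
    + Polynomial.C a
  have hp : p ≠ 0 := by
    intro h0
    have h2 : p.coeff 2 = c := by
      simp [p, Polynomial.coeff_X, Polynomial.coeff_C]
    rw [h0, Polynomial.coeff_zero] at h2
    exact sub_ne_zero.2 hy h2.symm
  have hfin : {t : ℝ | p.IsRoot (t : ℂ)}.Finite :=
    (Polynomial.finite_setOfPred_isRoot hp).preimage Complex.ofReal_injective.injOn
  have hd : Dense {t : ℝ | p.IsRoot (t : ℂ)}ᶜ := hfin.countable.dense_compl ℝ
  have hcont : Continuous fun t : ℝ => x + (t : ℂ) • y := by fun_prop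
  have key := map_mem_closure (t := {x : V | ⟪x, h x⟫_ℂ ≠ ⟪x, k x⟫_ℂ}) hcont (hd 0) (by
    intro t ht heq
    apply ht
    have e : p.eval (t : ℂ) = ⟪x + (t : ℂ) • y, h (x + (t : ℂ) • y)⟫_ℂ
        - ⟪x + (t : ℂ) • y, k (x + (t : ℂ) • y)⟫_ℂ := by
      simp only [p, map_add, map_smul, inner_add_left, inner_add_right, inner_smul_left,
        inner_smul_right, Complex.conj_ofReal, Polynomial.eval_add, Polynomial.eval_mul,
        Polynomial.eval_C, Polynomial.eval_pow, Polynomial.eval_X, ha, hb, hc]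
      ring
    show p.eval (t : ℂ) = 0
    rw [e, heq, sub_self])
  simpa using key
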